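/- For source masses p_1 ≤ … ≤ p_m with m ≥ 2, there exist an optimal decoding tree and an integer k with 2 ≤ k ≤ min(q_n, m) such that the tree has an internal node of class i*, where q_{i*} is the smallest among {q_1,…,q_n} with q_{i*} ≥ k, whose children are exactly k non-dummy leaves together with q_{i*} − k dummy leaves, and the tree contains no other dummy leaves; in particular, the number of dummy leaves required is w = q_{i*} − k. -/

import Mathlib

/-- A multi-channel decoding tree for an `n`-channel system with alphabet sizes `q i`:
leaves carry probability masses and every internal node is assigned a channel class
`i ∈ {1,…,n}`. -/
inductive PTree (n : ℕ) (q : Fin n → ℕ) : Type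
  | leaf (mass : ℝ) : PTree n q
  | node (i : Fin n) (children : List (PTree n q)) : PTree n q

namespace PTree

variable {n : ℕ} {q : Fin n → ℕ}

/-- The list of leaf masses of a decoding tree (in left-to-right order). -/
def leafMasses : PTree n q → List ℝ
  | .leaf x => [x]
  | .node _ cs => (cs.attach.map fun c => leafMasses c.1).flatten
decreasing_by
  simp_wf
  have := List.sizeOf_lt_of_mem c.2
  omega

/-- The total leaf mass of a tree; for a subtree rooted at an internal node this is the
reaching probability `s` of that node. -/
noncomputable def mass (t : PTree n q) : ℝ := t.leafMasses.sum

/-- Well-formedness of a decoding tree: every internal node of class `i` has at least one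
and at most `q i` children (its outgoing edges being labeled by distinct symbols of the
`i`-th alphabet), and all its subtrees are well-formed. -/
inductive WF : PTree n q → Prop
  | leaf (x : ℝ) : WF (.leaf x)
  | node (i : Fin n) (cs : List (PTree n q)) :
      cs ≠ [] → cs.length ≤ q i → (∀ c ∈ cs, WF c) → WF (.node i cs)

/-- The list of pairs (leaf mass, description length of the leaf), where the description
length of a leaf is the sum of `ln (q i)` over its internal-node ancestors of class `i`. -/
noncomputable def leafData : PTree n q → List (ℝ × ℝ)
  | .leaf x => [(x, 0)]
  | .node i cs =>
      ((cs.attach.map fun c => leafData c.1).flatten).map fun pr =>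
        (pr.1, pr.2 + Real.log (q i))
decreasing_by
  simp_wf
  have := List.sizeOf_lt_of_mem c.2
  omega

/-- The expected codeword (description) length of the tree in nats: the expectation of the
leaf description lengths under the leaf masses. -/
noncomputable def expLen (t : PTree n q) : ℝ := (t.leafData.map fun pr => pr.1 * pr.2).sum

/-- The subtree of `t` at a position given by a path of child indices (`none` if the path
does not exist in `t`).  Positions serve as names for the node occurrences of the tree. -/
def subtreeAt : PTree n q → List ℕ → Option (PTree n q)
  | t, [] => some t
  | .leaf _, _ :: _ => none
  | .node _ cs, a :: rest => (cs[a]?).bind fun c => subtreeAt c rest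

/-- `IsTreeFor p t`: `t` is a decoding tree for the source with masses `p`, i.e. `t` is
well-formed and its leaves are assigned the masses `p 1, …, p m` together with some number
`w` of dummy leaves of mass `0`. -/
def IsTreeFor {m : ℕ} (p : Fin m → ℝ) (t : PTree n q) : Prop :=
  t.WF ∧ ∃ w : ℕ, (t.leafMasses : Multiset ℝ) =
    ((List.ofFn p : List ℝ) : Multiset ℝ) + Multiset.replicate w 0

/-- `IsOptimal p t`: `t` is an optimal decoding tree for the source with masses `p`, i.e.
it attains the minimum expected codeword length over all decoding trees for the source
(with any number of dummy leaves). -/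
def IsOptimal {m : ℕ} (p : Fin m → ℝ) (t : PTree n q) : Prop :=
  IsTreeFor p t ∧ ∀ t' : PTree n q, IsTreeFor p t' → t.expLen ≤ t'.expLen

end PTree

namespace PTree

variable {n : ℕ} {q : Fin n → ℕ}

lemma leafMasses_leaf (x : ℝ) : (leaf x : PTree n q).leafMasses = [x] := by
  rw [leafMasses]

lemma leafMasses_node (i : Fin n) (cs : List (PTree n q)) :
    (node i cs).leafMasses = cs.flatMap leafMasses := by
  rw [leafMasses, List.attach_map_val, List.flatMap_def]

lemma leafData_node (i : Fin n) (cs : List (PTree n q)) :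
    (node i cs).leafData =
      (cs.flatMap leafData).map fun pr => (pr.1, pr.2 + Real.log (q i)) := by
  rw [leafData, List.attach_map_val, List.flatMap_def]

lemma expLen_leaf (x : ℝ) : (leaf x : PTree n q).expLen = 0 := by
  simp [expLen, leafData]

lemma sum_leafData_shift (l : List (ℝ × ℝ)) (a : ℝ) :
    ((l.map fun pr => (pr.1, pr.2 + a)).map fun pr => pr.1 * pr.2).sum =
      (l.map fun pr => pr.1 * pr.2).sum + (l.map Prod.fst).sum * a := by
  induction l with
  | nil => simp
  | cons b l ih =>
    simp only [List.map_cons, List.sum_cons, ih]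
    ring

lemma map_fst_leafData {t : PTree n q} (ht : t.WF) :
    t.leafData.map Prod.fst = t.leafMasses := by
  induction ht with
  | leaf x => simp [leafData, leafMasses]
  | node i cs _ _ _ ih =>
    rw [leafData_node, leafMasses_node, List.map_map, Function.comp_def, List.map_flatMap]
    simp only [List.flatMap_def]
    congr 1
    exact List.map_congr_left ih

lemma sum_map_flatMap_leafData (cs : List (PTree n q)) :
    ((cs.flatMap leafData).map fun pr => pr.1 * pr.2).sum = (cs.map expLen).sum := by
  induction cs with
  | nil => simp
  | cons c cs ih => simp [ih, expLen]

lemma map_fst_flatMap_leafData {cs : List (PTree n q)} (h : ∀ c ∈ cs, c.WF) :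
    (cs.flatMap leafData).map Prod.fst = cs.flatMap leafMasses := by
  rw [List.map_flatMap]
  simp only [List.flatMap_def]
  congr 1
  exact List.map_congr_left fun c hc => map_fst_leafData (h c hc)

lemma expLen_node (i : Fin n) {cs : List (PTree n q)} (h : ∀ c ∈ cs, c.WF) :
    (node i cs).expLen =
      (cs.map expLen).sum + (cs.flatMap leafMasses).sum * Real.log (q i) := by
  rw [expLen, leafData_node, sum_leafData_shift, sum_map_flatMap_leafData,
    map_fst_flatMap_leafData h]

lemma expLen_mem_closure {S : Set ℝ} {t : PTree n q} (ht : t.WF)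
    (hS : ∀ x ∈ t.leafMasses, ∀ i, x * Real.log (q i) ∈ AddSubmonoid.closure S) :
    t.expLen ∈ AddSubmonoid.closure S := by
  induction ht with
  | leaf x => simp [expLen_leaf]
  | node i cs _ _ hcs ih =>
    rw [leafMasses_node] at hS
    rw [expLen_node i hcs, ← List.map_id (cs.flatMap leafMasses),
      ← List.sum_map_mul_right]
    refine add_mem (list_sum_mem ?_) (list_sum_mem ?_)
    · simp only [List.mem_map]
      rintro _ ⟨c, hc, rfl⟩
      exact ih c hc fun x hx => hS x (List.mem_flatMap.2 ⟨c, hc, hx⟩)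
    · simp only [List.mem_map]
      rintro _ ⟨x, hx, rfl⟩
      exact hS x hx i

lemma expLen_nonneg {t : PTree n q} (ht : t.WF) (h : ∀ x ∈ t.leafMasses, 0 ≤ x) :
    0 ≤ t.expLen := by
  have hmem : t.expLen ∈ AddSubmonoid.closure (Set.Ici (0 : ℝ)) :=
    expLen_mem_closure ht fun x hx i => AddSubmonoid.subset_closure
      (mul_nonneg (h x hx) (Real.log_natCast_nonneg _))
  have hle : AddSubmonoid.closure (Set.Ici (0 : ℝ)) ≤ AddSubmonoid.nonneg ℝ :=
    AddSubmonoid.closure_le.2 fun x hx => hx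
  exact hle hmem

lemma exists_wf_leafMasses_eq (i : Fin n) (hi : 2 ≤ q i) (l : List ℝ) (hl : l ≠ []) :
    ∃ t : PTree n q, t.WF ∧ t.leafMasses = l := by
  induction l with
  | nil => exact absurd rfl hl
  | cons x l ih =>
    rcases eq_or_ne l [] with rfl | h
    · exact ⟨leaf x, .leaf x, leafMasses_leaf x⟩
    · obtain ⟨t, ht, rfl⟩ := ih h
      refine ⟨node i [leaf x, t], .node i _ (by simp) (by simpa using hi) ?_, ?_⟩
      · simpa using ⟨WF.leaf x, ht⟩
      · simp [leafMasses_node, leafMasses_leaf]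

lemma IsTreeFor.leafMasses_eq_zero_or {m : ℕ} {p : Fin m → ℝ}
    {t : PTree n q} (ht : IsTreeFor p t) : ∀ x ∈ t.leafMasses, x = 0 ∨ ∃ j, p j = x := by
  obtain ⟨-, w, hw⟩ := ht
  intro x hx
  rw [← Multiset.mem_coe, hw, Multiset.mem_add, Multiset.mem_coe, List.mem_ofFn] at hx
  rcases hx with h | h
  · exact .inr h
  · exact .inl (Multiset.eq_of_mem_replicate h)

/-- The expected lengths of the trees for `p` lie in the additive monoid generated by the
finitely many nonnegative numbers `p j * log (q i)`, so the minimum is attained. -/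
lemma exists_isOptimal (hn : 0 < n) (hq : ∀ i, 2 ≤ q i) {m : ℕ} (hm : m ≠ 0)
    {p : Fin m → ℝ} (hp : ∀ j, 0 < p j) : ∃ t : PTree n q, IsOptimal p t := by
  set S : Set ℝ := Set.range fun a : Fin m × Fin n => p a.1 * Real.log (q a.2) with hS
  have hpwo : (AddSubmonoid.closure S : Set ℝ).IsPWO := by
    refine Set.IsPWO.addSubmonoid_closure ?_ (Set.finite_range _).isPWO
    rintro _ ⟨a, rfl⟩
    exact mul_nonneg (hp _).le (Real.log_natCast_nonneg _)
  have hsub : expLen '' {t : PTree n q | IsTreeFor p t} ⊆ AddSubmonoid.closure S := by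
    rintro _ ⟨t, ht, rfl⟩
    refine expLen_mem_closure ht.1 fun x hx i => ?_
    rcases ht.leafMasses_eq_zero_or x hx with rfl | ⟨j, rfl⟩
    · simp
    · exact AddSubmonoid.subset_closure ⟨(j, i), rfl⟩
  have hne : (expLen '' {t : PTree n q | IsTreeFor p t}).Nonempty := by
    obtain ⟨t, ht, hl⟩ := exists_wf_leafMasses_eq (q := q) ⟨0, hn⟩ (hq _) (List.ofFn p)
      (by simpa using hm)
    exact ⟨_, t, ⟨ht, 0, by simp [hl]⟩, rfl⟩
  have hwf := (hpwo.mono hsub).isWF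
  obtain ⟨t, ht, hmin⟩ := hwf.min_mem hne
  exact ⟨t, ht, fun t' ht' => hmin.trans_le (hwf.min_le hne ⟨t', ht', rfl⟩)⟩

/-- A tree without zero-mass leaves whose internal nodes all have at least two children. -/
inductive Reduced : PTree n q → Prop
  | leaf (x : ℝ) : x ≠ 0 → Reduced (.leaf x)
  | node (i : Fin n) (cs : List (PTree n q)) :
      2 ≤ cs.length → cs.length ≤ q i → (∀ c ∈ cs, Reduced c) → Reduced (.node i cs)

lemma Reduced.wf {t : PTree n q} (ht : t.Reduced) : t.WF := by
  induction ht with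
  | leaf x _ => exact .leaf x
  | node i cs h2 hle _ ih => exact .node i cs (by rintro rfl; simp at h2) hle ih

lemma Reduced.leafMasses_ne_nil {t : PTree n q} (ht : t.Reduced) : t.leafMasses ≠ [] := by
  induction ht with
  | leaf x _ => simp [leafMasses_leaf]
  | node i cs h2 _ _ ih =>
    rw [leafMasses_node]
    match cs, h2 with
    | c :: _, _ => simp [ih c (by simp)]

lemma Reduced.subtreeAt_ne_zero {t : PTree n q} (ht : t.Reduced) (pos : List ℕ) :
    t.subtreeAt pos ≠ some (.leaf 0) := by
  induction ht generalizing pos with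
  | leaf x hx =>
    cases pos <;> simp [subtreeAt, hx]
  | node i cs _ _ _ ih =>
    cases pos with
    | nil => simp [subtreeAt]
    | cons a rest =>
      rw [subtreeAt]
      cases h : cs[a]? with
      | none => simp
      | some c => exact ih c (List.mem_of_getElem? h) rest

lemma sum_filter_ne_zero (l : List ℝ) : (l.filter (· ≠ 0)).sum = l.sum := by
  induction l with
  | nil => simp
  | cons x l ih => by_cases hx : x = 0 <;> simp_all

/-- The reductions of a list of trees can be collected, dropping the trees of zero mass. -/
lemma exists_reduced_list (cs : List (PTree n q)) (hnn : ∀ c ∈ cs, 0 ≤ c.expLen)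
    (h : ∀ c ∈ cs, c.leafMasses.filter (· ≠ 0) = [] ∨ ∃ t : PTree n q, t.Reduced ∧
      t.leafMasses = c.leafMasses.filter (· ≠ 0) ∧ t.expLen ≤ c.expLen) :
    ∃ ds : List (PTree n q), (∀ d ∈ ds, d.Reduced) ∧ ds.length ≤ cs.length ∧
      ds.flatMap leafMasses = (cs.flatMap leafMasses).filter (· ≠ 0) ∧
      (ds.map expLen).sum ≤ (cs.map expLen).sum := by
  induction cs with
  | nil => exact ⟨[], by simp⟩
  | cons c cs ih =>
    obtain ⟨ds, hr, hlen, hm, he⟩ := ih (fun d hd => hnn d (by simp [hd]))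
      fun d hd => h d (by simp [hd])
    have hc := hnn c (by simp)
    rcases h c (by simp) with h0 | ⟨t, ht, htm, hte⟩
    · refine ⟨ds, hr, by simp; omega, ?_, ?_⟩
      · rw [List.flatMap_cons, List.filter_append, h0, hm, List.nil_append]
      · rw [List.map_cons, List.sum_cons]
        linarith
    · refine ⟨t :: ds, by simpa using ⟨ht, hr⟩, by simpa using hlen, ?_, ?_⟩
      · rw [List.flatMap_cons, List.flatMap_cons, List.filter_append, hm, htm]
      · simp only [List.map_cons, List.sum_cons]
        linarith

lemma exists_reduced {t : PTree n q} (ht : t.WF) (hpos : ∀ x ∈ t.leafMasses, 0 ≤ x) :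
    t.leafMasses.filter (· ≠ 0) = [] ∨ ∃ t' : PTree n q, t'.Reduced ∧
      t'.leafMasses = t.leafMasses.filter (· ≠ 0) ∧ t'.expLen ≤ t.expLen := by
  induction ht with
  | leaf x =>
    by_cases hx : x = 0
    · simp [leafMasses_leaf, hx]
    · exact .inr ⟨leaf x, .leaf x hx, by simp [leafMasses_leaf, hx], le_rfl⟩
  | node i cs _ hle hcs ih =>
    rw [leafMasses_node] at hpos ⊢
    have hpos' : ∀ c ∈ cs, ∀ x ∈ c.leafMasses, 0 ≤ x := fun c hc x hx =>
      hpos x (List.mem_flatMap.2 ⟨c, hc, hx⟩)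
    obtain ⟨ds, hr, hlen, hm, he⟩ := exists_reduced_list cs
      (fun c hc => expLen_nonneg (hcs c hc) (hpos' c hc)) fun c hc => ih c hc (hpos' c hc)
    have hsum : (ds.flatMap leafMasses).sum = (cs.flatMap leafMasses).sum := by
      rw [hm, sum_filter_ne_zero]
    have hnode := expLen_node i hcs
    match ds, hr, hlen, hm, he, hsum with
    | [], _, _, hm, _, _ => exact .inl hm.symm
    | [d], hr, _, hm, he, _ =>
      refine .inr ⟨d, hr d (by simp), by simpa using hm, ?_⟩
      have := mul_nonneg (List.sum_nonneg hpos) (Real.log_natCast_nonneg (q i))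
      simp only [List.map_cons, List.map_nil, List.sum_cons, List.sum_nil] at he
      linarith
    | d :: e :: ds, hr, hlen, hm, he, hsum =>
      refine .inr ⟨node i (d :: e :: ds), .node i _ (by simp) (hlen.trans hle) hr, ?_, ?_⟩
      · rw [leafMasses_node, hm]
      · rw [expLen_node i fun c hc => (hr c hc).wf, hnode, hsum]
        linarith

/-- The zero leaves of `t` are all children of one node of class `i`, which has `q i` children
in total when `k ≤ q i`, the other `k` of them being leaves of nonzero mass. -/
def HasMergedNode (t : PTree n q) (k : ℕ) (i : Fin n) : Prop :=
  ∃ (pos : List ℕ) (nds : List (PTree n q)),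
    t.subtreeAt pos = some (.node i (List.replicate (q i - k) (PTree.leaf 0) ++ nds)) ∧
    nds.length = k ∧ (∀ c ∈ nds, ∃ x : ℝ, x ≠ 0 ∧ c = PTree.leaf x) ∧
    ∀ pos' : List ℕ, t.subtreeAt pos' = some (.leaf 0) → ∃ a : ℕ, pos' = pos ++ [a]

lemma length_le_length_flatMap_leafMasses {cs : List (PTree n q)}
    (h : ∀ c ∈ cs, c.Reduced) : cs.length ≤ (cs.flatMap leafMasses).length := by
  induction cs with
  | nil => simp
  | cons c cs ih =>
    have h1 := List.length_pos_iff.2 (h c (by simp)).leafMasses_ne_nil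
    have h2 := ih fun d hd => h d (by simp [hd])
    simp only [List.flatMap_cons, List.length_append, List.length_cons]
    omega

lemma flatMap_leafMasses_replicate (w : ℕ) :
    (List.replicate w (leaf 0 : PTree n q)).flatMap leafMasses = List.replicate w 0 := by
  induction w with
  | zero => simp
  | succ w ih => simp [List.replicate_succ, ih, leafMasses_leaf]

/-- A lowest internal node of a reduced tree may be padded with zero leaves, and its class
replaced by one with a smaller sufficient alphabet. -/
lemma Reduced.exists_hasMergedNode {t : PTree n q} (hq : ∀ i, 2 ≤ q i) (ht : t.Reduced)
    (hpos : ∀ x ∈ t.leafMasses, 0 ≤ x) :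
    (∃ x, t = .leaf x) ∨ ∃ (k : ℕ) (i : Fin n), 2 ≤ k ∧ k ≤ q i ∧
      k ≤ t.leafMasses.length ∧ ∀ j, k ≤ q j → q j ≤ q i → ∃ t' : PTree n q, t'.WF ∧
        t'.leafMasses.Perm (List.replicate (q j - k) 0 ++ t.leafMasses) ∧
        t'.expLen ≤ t.expLen ∧ t'.HasMergedNode k j := by
  induction ht with
  | leaf x _ => exact .inl ⟨x, rfl⟩
  | node i cs h2 hle hcs ih =>
    right
    rw [leafMasses_node] at hpos ⊢
    have hlog : ∀ j, q j ≤ q i → Real.log (q j) ≤ Real.log (q i) := fun j hj =>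
      Real.log_le_log (by have := hq j; positivity) (by exact_mod_cast hj)
    by_cases hall : ∀ c ∈ cs, ∃ x, c = .leaf x
    · refine ⟨cs.length, i, h2, hle, length_le_length_flatMap_leafMasses hcs,
        fun j hj hji => ?_⟩
      have hwf : ∀ c ∈ List.replicate (q j - cs.length) (PTree.leaf 0) ++ cs, c.WF := by
        intro c hc
        rcases List.mem_append.1 hc with h | h
        · rw [List.eq_of_mem_replicate h]
          exact .leaf 0
        · exact (hcs c h).wf
      refine ⟨.node j (List.replicate (q j - cs.length) (PTree.leaf 0) ++ cs),
        .node j _ ?_ ?_ hwf, ?_, ?_, [], cs, rfl, rfl, ?_, ?_⟩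
      · intro h
        simp only [List.append_eq_nil_iff] at h
        simp [h.2] at h2
      · simp only [List.length_append, List.length_replicate]
        omega
      · rw [leafMasses_node, List.flatMap_append, flatMap_leafMasses_replicate]
      · rw [expLen_node j hwf, expLen_node i fun c hc => (hcs c hc).wf,
          List.flatMap_append, flatMap_leafMasses_replicate]
        have := mul_le_mul_of_nonneg_left (hlog j hji) (List.sum_nonneg hpos)
        simpa [expLen_leaf] using this
      · intro c hc
        obtain ⟨x, rfl⟩ := hall c hc
        cases hcs _ hc with
        | leaf _ hx => exact ⟨x, hx, rfl⟩
      · intro pos' h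
        match pos', h with
        | [], h => simp [subtreeAt] at h
        | [a], _ => exact ⟨a, rfl⟩
        | a :: b :: rest, h =>
          rw [subtreeAt] at h
          cases hc : (List.replicate (q j - cs.length) (PTree.leaf 0) ++ cs)[a]? with
          | none => simp [hc] at h
          | some c =>
            obtain ⟨x, rfl⟩ : ∃ x, c = .leaf x := by
              rcases List.mem_append.1 (List.mem_of_getElem? hc) with h | h
              · exact ⟨0, List.eq_of_mem_replicate h⟩
              · exact hall c h
            simp [hc, subtreeAt] at h
    · push Not at hall
      obtain ⟨c, hc, hleaf⟩ := hall
      obtain ⟨k, i', hk2, hki, hkl, hk⟩ := (ih c hc fun x hx =>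
        hpos x (List.mem_flatMap.2 ⟨c, hc, hx⟩)).resolve_left fun ⟨x, hx⟩ => hleaf x hx
      obtain ⟨l₁, l₂, rfl⟩ := List.append_of_mem hc
      refine ⟨k, i', hk2, hki, ?_, fun j hj hji => ?_⟩
      · simp only [List.flatMap_append, List.flatMap_cons, List.length_append]
        omega
      obtain ⟨c', hwf', hperm, hexp, pos, nds, hat, hnds, hnl, hz⟩ := hk j hj hji
      have hwf : ∀ d ∈ l₁ ++ c' :: l₂, d.WF := by
        intro d hd
        simp only [List.mem_append, List.mem_cons] at hd
        rcases hd with h | rfl | h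
        · exact (hcs d (by simp [h])).wf
        · exact hwf'
        · exact (hcs d (by simp [h])).wf
      have hp' : ((l₁ ++ c' :: l₂).flatMap leafMasses).Perm
          (List.replicate (q j - k) 0 ++ (l₁ ++ c :: l₂).flatMap leafMasses) := by
        simp only [List.flatMap_append, List.flatMap_cons]
        refine ((hperm.append_right _).append_left _).trans ?_
        simp only [← List.append_assoc]
        exact ((List.perm_append_comm.append_right _).append_right _)
      refine ⟨.node i (l₁ ++ c' :: l₂), .node i _ (by simp) (by simpa using hle) hwf, ?_, ?_,
        l₁.length :: pos, nds, ?_, hnds, hnl, ?_⟩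
      · rwa [leafMasses_node]
      · rw [expLen_node i hwf, expLen_node i fun c hc => (hcs c hc).wf, hp'.sum_eq]
        simpa using hexp
      · simpa [subtreeAt] using hat
      · intro pos' h
        cases pos' with
        | nil => simp [subtreeAt] at h
        | cons a rest =>
          rw [subtreeAt] at h
          rcases eq_or_ne a l₁.length with rfl | ha
          · obtain ⟨b, rfl⟩ := hz rest (by simpa using h)
            exact ⟨b, rfl⟩
          · exfalso
            cases hd : (l₁ ++ c' :: l₂)[a]? with
            | none => simp [hd] at h
            | some d =>
              have hmem : d ∈ l₁ ++ c :: l₂ := by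
                refine List.mem_of_getElem? (i := a) ?_
                rw [← hd]
                grind
              exact (hcs d hmem).subtreeAt_ne_zero rest (by simpa [hd] using h)

end PTree

/-- There exist an optimal decoding tree and an integer `k` with `2 ≤ k ≤ min (q n) m` such
that the tree has an internal node of class `i*` — where `q i*` is the smallest alphabet
size with `q i* ≥ k` — whose children are exactly `k` non-dummy leaves together with
`q i* - k` dummy leaves, and the tree contains no other dummy leaves; in particular the
number of dummy leaves required is `w = q i* - k`. -/
theorem exists_optimal_tree_merged_node_structure (n : ℕ) (hn : 0 < n)
    (q : Fin n → ℕ) (hq : ∀ i, 2 ≤ q i) (hmono : Monotone q)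
    (m : ℕ) (hm : 2 ≤ m) (p : Fin m → ℝ) (hmp : Monotone p) (hp : ∀ j, 0 < p j)
    (hsum : ∑ j, p j = 1) :
    ∃ (t : PTree n q) (k : ℕ), PTree.IsOptimal p t ∧
      2 ≤ k ∧ k ≤ min (q ⟨n - 1, Nat.sub_lt hn Nat.one_pos⟩) m ∧
      ∃ (pos : List ℕ) (iStar : Fin n) (cs : List (PTree n q)),
        t.subtreeAt pos = some (.node iStar cs) ∧
        k ≤ q iStar ∧ (∀ i : Fin n, k ≤ q i → q iStar ≤ q i) ∧
        (∃ nds : List (PTree n q),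
          cs.Perm (List.replicate (q iStar - k) (PTree.leaf 0) ++ nds) ∧
          nds.length = k ∧ ∀ c ∈ nds, ∃ x : ℝ, x ≠ 0 ∧ c = PTree.leaf x) ∧
        (∀ pos' : List ℕ, t.subtreeAt pos' = some (.leaf 0) →
          ∃ a : ℕ, pos' = pos ++ [a]) := by
  obtain ⟨t₀, ht₀, hmin⟩ := PTree.exists_isOptimal hn hq (by omega : m ≠ 0) hp
  have hpos : ∀ x ∈ t₀.leafMasses, 0 ≤ x := fun x hx => by
    rcases ht₀.leafMasses_eq_zero_or x hx with rfl | ⟨j, rfl⟩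
    exacts [le_rfl, (hp j).le]
  have hfilter : ((t₀.leafMasses.filter (· ≠ 0) : List ℝ) : Multiset ℝ) = List.ofFn p := by
    obtain ⟨w, hw⟩ := ht₀.2
    rw [← Multiset.filter_coe, hw, Multiset.filter_add, Multiset.filter_eq_self.2,
      Multiset.filter_eq_nil.2, add_zero]
    · intro x hx
      simp [Multiset.eq_of_mem_replicate hx]
    · intro x hx
      obtain ⟨j, rfl⟩ := List.mem_ofFn.1 hx
      exact (hp j).ne'
  have hlen : (t₀.leafMasses.filter (· ≠ 0)).length = m := by
    simpa using congrArg Multiset.card hfilter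
  obtain ⟨t₁, hred, hmass, hexp⟩ := (PTree.exists_reduced ht₀.1 hpos).resolve_left fun h => by
    simp only [h, List.length_nil] at hlen
    omega
  rw [← hmass] at hfilter hlen
  obtain ⟨k, i, hk2, hki, hkm, hk⟩ := (hred.exists_hasMergedNode hq fun x hx => by
    rw [hmass] at hx
    exact hpos x (List.mem_filter.1 hx).1).resolve_left fun ⟨x, hx⟩ => by
      simp only [hx, PTree.leafMasses_leaf, List.length_singleton] at hlen
      omega
  obtain ⟨j, hj, hjmin⟩ := Set.exists_min_image {j | k ≤ q j} q (Set.toFinite _) ⟨i, hki⟩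
  obtain ⟨t, hwf, hperm, hexp', pos, nds, hat, hnds, hnl, hz⟩ := hk j hj (hjmin i hki)
  refine ⟨t, k, ⟨⟨hwf, q j - k, ?_⟩, fun t' ht' => (hexp'.trans hexp).trans (hmin t' ht')⟩,
    hk2, le_min (hki.trans (hmono ?_)) (hlen ▸ hkm), pos, j, _, hat, hj, hjmin,
    ⟨nds, .refl _, hnds, hnl⟩, hz⟩
  · rw [Multiset.coe_eq_coe.2 hperm, ← Multiset.coe_add, hfilter, Multiset.coe_replicate,
      add_comm]
  · exact Fin.le_def.2 (Nat.le_sub_one_of_lt i.2)
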